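/- Exactly thirteen of the 121 points of the cubic surface S₁ over 𝔽₈ are Eckardt points: the number of points [v] of ℙ³(𝔽₈) with f₁(v) = 0 that are contained in three distinct lines of the surface defined over 𝔽₈ equals 13. -/

import Mathlib

open MvPolynomial

/-- The cubic form `Y³ + Y²Z + Z³ + W(X² + Y² + YZ + Z²) + XW² + W³` with the variables
`X, Y, Z, W` indexed by `0, 1, 2, 3`, over any commutative ring (its coefficients lie in `𝔽₂`). -/
noncomputable def f₁ (K : Type*) [CommRing K] : MvPolynomial (Fin 4) K :=
  X 1 ^ 3 + X 1 ^ 2 * X 2 + X 2 ^ 3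
    + X 3 * (X 0 ^ 2 + X 1 ^ 2 + X 1 * X 2 + X 2 ^ 2) + X 0 * X 3 ^ 2 + X 3 ^ 3

/-- A line of the surface `S₁` over `𝔽₈`: a 2-dimensional linear subspace of `𝔽₈⁴` on which
`f₁` vanishes identically. -/
def IsLineOfS₁F8 (W : Submodule (GaloisField 2 3) (Fin 4 → GaloisField 2 3)) : Prop :=
  Module.finrank (GaloisField 2 3) W = 2 ∧ ∀ v ∈ W, eval v (f₁ (GaloisField 2 3)) = 0

section Polar

variable {K : Type*} [Field K]

theorem eval_f₁ (v : Fin 4 → K) :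
    eval v (f₁ K) = v 1 ^ 3 + v 1 ^ 2 * v 2 + v 2 ^ 3
      + v 3 * (v 0 ^ 2 + v 1 ^ 2 + v 1 * v 2 + v 2 ^ 2) + v 0 * v 3 ^ 2 + v 3 ^ 3 := by
  simp [f₁]

/-- The polarization of `f₁`: the gradient of `f₁` at `v`, paired with `u`. -/
def polarF₁ (v u : Fin 4 → K) : K :=
  v 3 ^ 2 * u 0 + (v 1 ^ 2 + v 3 * v 2) * u 1 + (v 1 ^ 2 + v 2 ^ 2 + v 3 * v 1) * u 2
    + (v 0 ^ 2 + v 1 ^ 2 + v 1 * v 2 + v 2 ^ 2 + v 3 ^ 2) * u 3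

theorem eval_f₁_smul_add_smul [CharP K 2] (v u : Fin 4 → K) (s t : K) :
    eval (s • v + t • u) (f₁ K) = s ^ 3 * eval v (f₁ K) + s ^ 2 * t * polarF₁ v u
      + s * t ^ 2 * polarF₁ u v + t ^ 3 * eval u (f₁ K) := by
  have h2 : (2 : K) = 0 := CharTwo.two_eq_zero
  simp only [eval_f₁, polarF₁, Pi.add_apply, Pi.smul_apply, smul_eq_mul]
  grind

theorem polarF₁_eq_zero_of_mem [CharP K 2] {W : Submodule K (Fin 4 → K)}
    (hW : ∀ v ∈ W, eval v (f₁ K) = 0) {γ : K} (h0 : γ ≠ 0) (h1 : γ ≠ 1)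
    {v u : Fin 4 → K} (hv : v ∈ W) (hu : u ∈ W) : polarF₁ v u = 0 := by
  have h (s : K) := hW _ (W.add_mem (W.smul_mem s hv) (W.smul_mem 1 hu))
  have e1 := h 1
  have eγ := h γ
  rw [eval_f₁_smul_add_smul, hW v hv, hW u hu] at e1 eγ
  have : (γ * (γ - 1)) * polarF₁ v u = 0 := by linear_combination eγ - γ * e1
  exact (mul_eq_zero.mp this).resolve_left (mul_ne_zero h0 (sub_ne_zero.mpr h1))

theorem eq_zero_of_three_zeros {A B C : K} {y₁ z₁ y₂ z₂ y₃ z₃ : K}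
    (h₁ : A * y₁ ^ 2 + B * z₁ ^ 2 + C * (y₁ * z₁) = 0)
    (h₂ : A * y₂ ^ 2 + B * z₂ ^ 2 + C * (y₂ * z₂) = 0)
    (h₃ : A * y₃ ^ 2 + B * z₃ ^ 2 + C * (y₃ * z₃) = 0)
    (h₁₂ : y₁ * z₂ - y₂ * z₁ ≠ 0) (h₁₃ : y₁ * z₃ - y₃ * z₁ ≠ 0)
    (h₂₃ : y₂ * z₃ - y₃ * z₂ ≠ 0) : C = 0 := by
  have : C * ((y₁ * z₂ - y₂ * z₁) * (y₁ * z₃ - y₃ * z₁) * (y₂ * z₃ - y₃ * z₂)) = 0 := by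
    linear_combination
      (-(y₂ ^ 2 * z₃ ^ 2 - y₃ ^ 2 * z₂ ^ 2)) * h₁ + (y₁ ^ 2 * z₃ ^ 2 - y₃ ^ 2 * z₁ ^ 2) * h₂
        - (y₁ ^ 2 * z₂ ^ 2 - y₂ ^ 2 * z₁ ^ 2) * h₃
  simpa [h₁₂, h₁₃, h₂₃] using this

end Polar

section Plane

variable {K : Type*} [Field K] {n : ℕ}

theorem exists_mem_ne_zero_apply_eq_zero {W : Submodule K (Fin n → K)}
    (hW : Module.finrank K W = 2) {v : Fin n → K} (hv : v ∈ W) {i : Fin n} (hi : v i ≠ 0) :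
    ∃ u ∈ W, u ≠ 0 ∧ u i = 0 := by
  have : ¬ W ≤ K ∙ v := fun h => by
    have := Submodule.finrank_mono h
    have := finrank_span_singleton (K := K) (v := v) (by rintro rfl; simp at hi)
    omega
  obtain ⟨u, hu, huv⟩ := SetLike.not_le_iff_exists.mp this
  refine ⟨u - (u i / v i) • v, W.sub_mem hu (W.smul_mem _ hv), fun h => huv ?_, by simp [hi]⟩
  exact Submodule.mem_span_singleton.mpr ⟨_, (sub_eq_zero.mp h).symm⟩

theorem linearIndependent_pair_of_apply {v u : Fin n → K} {i : Fin n} (hi : v i ≠ 0)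
    (hu : u ≠ 0) (hui : u i = 0) : LinearIndependent K ![v, u] := by
  rw [LinearIndependent.pair_iff]
  intro s t h
  have hs : s = 0 := by simpa [hui, hi] using congrFun h i
  subst hs
  simpa [hu] using h

theorem eq_of_mem_of_mem {W W' : Submodule K (Fin n → K)} (hW : Module.finrank K W = 2)
    (hW' : Module.finrank K W' = 2) {v u : Fin n → K} {i : Fin n} (hi : v i ≠ 0) (hu : u ≠ 0)
    (hui : u i = 0) (hvW : v ∈ W) (huW : u ∈ W) (hvW' : v ∈ W') (huW' : u ∈ W') : W = W' := by
  have hfin := finrank_span_eq_card (linearIndependent_pair_of_apply hi hu hui)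
  have key (U : Submodule K (Fin n → K)) (hU : Module.finrank K U = 2) (hv : v ∈ U)
      (hu : u ∈ U) : Submodule.span K (Set.range ![v, u]) = U := by
    refine Submodule.eq_of_le_of_finrank_eq (Submodule.span_le.mpr ?_) (by simpa [hU] using hfin)
    rintro _ ⟨j, rfl⟩
    fin_cases j <;> simpa
  rw [← key W hW hvW huW, key W' hW' hvW' huW']

end Plane

local notation "𝔽₈" => GaloisField 2 3

/-- `v` lies on three distinct lines of `S₁` over `𝔽₈`. -/
def LiesOnThreeLines (v : Fin 4 → 𝔽₈) : Prop :=
  ∃ W₁ W₂ W₃ : Submodule 𝔽₈ (Fin 4 → 𝔽₈), W₁ ≠ W₂ ∧ W₁ ≠ W₃ ∧ W₂ ≠ W₃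
    ∧ IsLineOfS₁F8 W₁ ∧ IsLineOfS₁F8 W₂ ∧ IsLineOfS₁F8 W₃ ∧ v ∈ W₁ ∧ v ∈ W₂ ∧ v ∈ W₃

theorem exists_root_F8 : ∃ α : 𝔽₈, α ^ 3 + α ^ 2 + 1 = 0 := by
  have h2 : (2 : 𝔽₈) = 0 := CharTwo.two_eq_zero
  have hc : Nat.card 𝔽₈ = 8 := by simpa using GaloisField.card 2 3 (by norm_num)
  have : Finite 𝔽₈ := Nat.finite_of_card_ne_zero (by omega)
  have := Fintype.ofFinite 𝔽₈
  obtain ⟨γ, hγ⟩ : ∃ γ : 𝔽₈, γ ∉ ({0, 1} : Set 𝔽₈) := by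
    by_contra! h
    have h := (Set.eq_univ_of_forall h).symm
    have := congrArg Set.ncard h
    rw [Set.ncard_univ, hc, Set.ncard_pair zero_ne_one] at this
    omega
  have h8 : γ ^ 8 = γ := by
    have := FiniteField.pow_card γ
    rwa [← Nat.card_eq_fintype_card, hc] at this
  have hγ0 : γ ≠ 0 := fun h => hγ (by simp [h])
  have hγ1 : γ - 1 ≠ 0 := fun h => hγ (by simp [sub_eq_zero.mp h])
  have : γ * (γ - 1) * ((γ ^ 3 + γ ^ 2 + 1) * (γ ^ 3 + γ + 1)) = 0 := by grind
  have := (mul_eq_zero.mp this).resolve_left (mul_ne_zero hγ0 hγ1)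
  rcases mul_eq_zero.mp this with h | h
  · exact ⟨γ, h⟩
  · exact ⟨γ⁻¹, by field_simp; linear_combination h⟩

theorem ne_zero_of_root {α : 𝔽₈} (hα : α ^ 3 + α ^ 2 + 1 = 0) : α ≠ 0 := by
  rintro rfl
  simp at hα

theorem ne_one_of_root {α : 𝔽₈} (hα : α ^ 3 + α ^ 2 + 1 = 0) : α ≠ 1 := by
  have h2 : (2 : 𝔽₈) = 0 := CharTwo.two_eq_zero
  grind

theorem polarF₁_eq_zero_of_isLine {W : Submodule 𝔽₈ (Fin 4 → 𝔽₈)} (hW : IsLineOfS₁F8 W)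
    {v u : Fin 4 → 𝔽₈} (hv : v ∈ W) (hu : u ∈ W) : polarF₁ v u = 0 := by
  obtain ⟨γ, hγ⟩ := exists_root_F8
  exact polarF₁_eq_zero_of_mem hW.2 (ne_zero_of_root hγ) (ne_one_of_root hγ) hv hu

theorem isLineOfS₁F8_span_pair {v u : Fin 4 → 𝔽₈} (h : LinearIndependent 𝔽₈ ![v, u])
    (hv : eval v (f₁ 𝔽₈) = 0) (hu : eval u (f₁ 𝔽₈) = 0) (hvu : polarF₁ v u = 0)
    (huv : polarF₁ u v = 0) : IsLineOfS₁F8 (Submodule.span 𝔽₈ {v, u}) := by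
  refine ⟨?_, fun x hx => ?_⟩
  · rw [← Matrix.range_cons_cons_empty v u ![]]
    exact finrank_span_eq_card h
  obtain ⟨s, t, rfl⟩ := Submodule.mem_span_pair.mp hx
  simp [eval_f₁_smul_add_smul, hv, hu, hvu, huv]

theorem LiesOnThreeLines.apply_three_eq_zero {v : Fin 4 → 𝔽₈} (h : LiesOnThreeLines v) :
    v 3 = 0 := by
  have h2 : (2 : 𝔽₈) = 0 := CharTwo.two_eq_zero
  obtain ⟨W₁, W₂, W₃, h₁₂, h₁₃, h₂₃, L₁, L₂, L₃, hv₁, hv₂, hv₃⟩ := h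
  by_contra h3
  obtain ⟨u₁, hu₁, n₁, e₁⟩ := exists_mem_ne_zero_apply_eq_zero L₁.1 hv₁ h3
  obtain ⟨u₂, hu₂, n₂, e₂⟩ := exists_mem_ne_zero_apply_eq_zero L₂.1 hv₂ h3
  obtain ⟨u₃, hu₃, n₃, e₃⟩ := exists_mem_ne_zero_apply_eq_zero L₃.1 hv₃ h3
  have key {W W' : Submodule 𝔽₈ (Fin 4 → 𝔽₈)} (hne : W ≠ W') (L : IsLineOfS₁F8 W)
      (L' : IsLineOfS₁F8 W') (hv : v ∈ W) (hv' : v ∈ W') {u u' : Fin 4 → 𝔽₈} (hu : u ∈ W)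
      (hu' : u' ∈ W') (n : u ≠ 0) (n' : u' ≠ 0) (e : u 3 = 0) (e' : u' 3 = 0) :
      u 1 * u' 2 - u' 1 * u 2 ≠ 0 := by
    intro hm
    have p := polarF₁_eq_zero_of_isLine L hv hu
    have p' := polarF₁_eq_zero_of_isLine L' hv' hu'
    simp only [polarF₁, e, e', mul_zero, add_zero] at p p'
    suffices ∃ t : 𝔽₈, u' = t • u by
      obtain ⟨t, rfl⟩ := this
      exact hne (eq_of_mem_of_mem L.1 L'.1 h3 n' e' hv (W.smul_mem t hu) hv' hu')
    have p₁ : u 1 * u' 0 = u' 1 * u 0 := mul_left_cancel₀ (pow_ne_zero 2 h3) (by grind)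
    have p₂ : u 2 * u' 0 = u' 2 * u 0 := mul_left_cancel₀ (pow_ne_zero 2 h3) (by grind)
    by_cases k₁ : u 1 = 0
    · by_cases k₂ : u 2 = 0
      · have k₀ : u 0 = 0 := by simpa [k₁, k₂, h3] using p
        exact absurd (by ext i; fin_cases i <;> simp [*]) n
      · refine ⟨u' 2 / u 2, ?_⟩
        ext i
        fin_cases i <;> simp [e, e'] <;> grind
    · refine ⟨u' 1 / u 1, ?_⟩
      ext i
      fin_cases i <;> simp [e, e'] <;> grind
  have quad {W : Submodule 𝔽₈ (Fin 4 → 𝔽₈)} (L : IsLineOfS₁F8 W) (hv : v ∈ W)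
      {u : Fin 4 → 𝔽₈} (hu : u ∈ W) (e : u 3 = 0) :
      (v 3 ^ 4 * (v 1 + v 2 + v 3) + (v 1 ^ 2 + v 3 * v 2) ^ 2 * v 3) * u 1 ^ 2
        + (v 3 ^ 4 * (v 2 + v 3) + (v 1 ^ 2 + v 2 ^ 2 + v 3 * v 1) ^ 2 * v 3) * u 2 ^ 2
        + v 3 ^ 5 * (u 1 * u 2) = 0 := by
    have p := polarF₁_eq_zero_of_isLine L hv hu
    have q := polarF₁_eq_zero_of_isLine L hu hv
    simp only [polarF₁, e] at p q
    grind
  exact pow_ne_zero 5 h3 (eq_zero_of_three_zeros (quad L₁ hv₁ hu₁ e₁) (quad L₂ hv₂ hu₂ e₂)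
    (quad L₃ hv₃ hu₃ e₃) (key h₁₂ L₁ L₂ hv₁ hv₂ hu₁ hu₂ n₁ n₂ e₁ e₂)
    (key h₁₃ L₁ L₃ hv₁ hv₃ hu₁ hu₃ n₁ n₃ e₁ e₃) (key h₂₃ L₂ L₃ hv₂ hv₃ hu₂ hu₃ n₂ n₃ e₂ e₃))

theorem LiesOnThreeLines.root_of_normalized {x a : 𝔽₈} (h : LiesOnThreeLines ![x, a, 1, 0]) :
    a ^ 3 + a ^ 2 + 1 = 0 ∧ (x = 0 ∨ x = 1 ∨ x = a ∨ x = a + 1) := by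
  have h2 : (2 : 𝔽₈) = 0 := CharTwo.two_eq_zero
  obtain ⟨W₁, W₂, -, h₁₂, -, -, L₁, L₂, -, hv₁, hv₂, -⟩ := h
  have ha : a ^ 3 + a ^ 2 + 1 = 0 := by simpa [eval_f₁] using L₁.2 _ hv₁
  have ha0 := ne_zero_of_root ha
  refine ⟨ha, ?_⟩
  have key {W : Submodule 𝔽₈ (Fin 4 → 𝔽₈)} (L : IsLineOfS₁F8 W) (hv : ![x, a, 1, 0] ∈ W) :
      ![1, 0, 0, 0] ∈ W ∨ x = 0 ∨ x = 1 ∨ x = a ∨ x = a + 1 := by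
    obtain ⟨u, hu, hne, e⟩ := exists_mem_ne_zero_apply_eq_zero L.1 hv (i := 2) (by simp)
    have p := polarF₁_eq_zero_of_isLine L hv hu
    have q := polarF₁_eq_zero_of_isLine L hu hv
    simp [polarF₁, e] at p q
    by_cases hu3 : u 3 = 0
    · left
      have hu1 : u 1 = 0 := by simpa [hu3, ha0] using p
      have hu0 : u 0 ≠ 0 := fun h => hne (by ext i; fin_cases i <;> simp [*])
      convert W.smul_mem (u 0)⁻¹ hu using 1
      ext i
      fin_cases i <;> simp [*]
    · right
      have : u 3 ^ 2 * (x * (x - 1) * (x - a) * (x - (a + 1))) = 0 := by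
        grind
      simpa [hu3, sub_eq_zero, or_assoc] using this
  rcases key L₁ hv₁ with k₁ | k₁
  · rcases key L₂ hv₂ with k₂ | k₂
    · exact absurd (eq_of_mem_of_mem L₁.1 L₂.1 (i := 2) (by simp) (by simp) (by simp)
        hv₁ k₁ hv₂ k₂) h₁₂
    · exact k₂
  · exact k₁

theorem liesOnThreeLines_of_root {a x c r : 𝔽₈} (ha : a ^ 3 + a ^ 2 + 1 = 0)
    (hc : a ^ 2 * c + (x ^ 2 + a ^ 2 + a + 1) = 0) (hx : x + c ^ 2 * a + (c ^ 2 + c) = 0)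
    (hr : c ^ 3 + (r ^ 2 + c ^ 2) + r + 1 = 0) : LiesOnThreeLines ![x, a, 1, 0] := by
  have h2 : (2 : 𝔽₈) = 0 := CharTwo.two_eq_zero
  have notMem (r : 𝔽₈) : ![1, 0, 0, 0] ∉ Submodule.span 𝔽₈ {![x, a, 1, 0], ![r, c, 0, 1]} := by
    intro h
    obtain ⟨s, t, h⟩ := Submodule.mem_span_pair.mp h
    have e0 := congrFun h 0
    have e2 := congrFun h 2
    have e3 := congrFun h 3
    simp at e0 e2 e3
    simp [e2, e3] at e0
  have line (r : 𝔽₈) (hr : c ^ 3 + (r ^ 2 + c ^ 2) + r + 1 = 0) :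
      IsLineOfS₁F8 (Submodule.span 𝔽₈ {![x, a, 1, 0], ![r, c, 0, 1]}) := by
    apply isLineOfS₁F8_span_pair (linearIndependent_pair_of_apply (i := 2) (by simp)
      (fun h => by simpa using congrFun h 3) (by simp))
    all_goals simp [eval_f₁, polarF₁]; grind
  refine ⟨Submodule.span 𝔽₈ {![x, a, 1, 0], ![1, 0, 0, 0]},
    Submodule.span 𝔽₈ {![x, a, 1, 0], ![r, c, 0, 1]},
    Submodule.span 𝔽₈ {![x, a, 1, 0], ![r + 1, c, 0, 1]}, ?_, ?_, ?_, ?_,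
    line r hr, line (r + 1) (by grind), ?_, ?_, ?_⟩
  · exact fun h => notMem r (h ▸ Submodule.subset_span (by simp))
  · exact fun h => notMem (r + 1) (h ▸ Submodule.subset_span (by simp))
  · intro h
    have h₁ : ![r, c, 0, 1] ∈ Submodule.span 𝔽₈ {![x, a, 1, 0], ![r, c, 0, 1]} :=
      Submodule.subset_span (by simp)
    have h₂ : ![r + 1, c, 0, 1] ∈ Submodule.span 𝔽₈ {![x, a, 1, 0], ![r, c, 0, 1]} :=
      h ▸ Submodule.subset_span (by simp)
    refine notMem r ?_
    convert Submodule.sub_mem _ h₂ h₁ using 1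
    ext i
    fin_cases i <;> simp
  · apply isLineOfS₁F8_span_pair (linearIndependent_pair_of_apply (i := 2) (by simp)
      (fun h => by simpa using congrFun h 0) (by simp))
    all_goals simp [eval_f₁, polarF₁, ha]
  all_goals exact Submodule.subset_span (by simp)

theorem liesOnThreeLines_normalized_iff {x a : 𝔽₈} :
    LiesOnThreeLines ![x, a, 1, 0] ↔
      a ^ 3 + a ^ 2 + 1 = 0 ∧ (x = 0 ∨ x = 1 ∨ x = a ∨ x = a + 1) := by
  refine ⟨LiesOnThreeLines.root_of_normalized, ?_⟩
  have h2 : (2 : 𝔽₈) = 0 := CharTwo.two_eq_zero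
  rintro ⟨ha, rfl | rfl | rfl | rfl⟩
  · exact liesOnThreeLines_of_root (c := a ^ 2) (r := 0) ha (by grind) (by grind) (by grind)
  · exact liesOnThreeLines_of_root (c := a ^ 2 + a + 1) (r := 0) ha (by grind) (by grind)
      (by grind)
  · exact liesOnThreeLines_of_root (c := x ^ 2 + 1) (r := x ^ 2) ha (by grind) (by grind)
      (by grind)
  · exact liesOnThreeLines_of_root (c := a ^ 2 + a) (r := a ^ 2 + a) ha (by grind) (by grind)
      (by grind)

theorem root_iff {α a : 𝔽₈} (hα : α ^ 3 + α ^ 2 + 1 = 0) :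
    a ^ 3 + a ^ 2 + 1 = 0 ↔ a = α ∨ a = α ^ 2 ∨ a = α ^ 2 + α + 1 := by
  have h2 : (2 : 𝔽₈) = 0 := CharTwo.two_eq_zero
  have : a ^ 3 + a ^ 2 + 1 = (a - α) * ((a - α ^ 2) * (a - (α ^ 2 + α + 1))) := by grind
  rw [this, mul_eq_zero, mul_eq_zero, sub_eq_zero, sub_eq_zero, sub_eq_zero]

theorem liesOnThreeLines_basis : LiesOnThreeLines ![1, 0, 0, 0] := by
  have h2 : (2 : 𝔽₈) = 0 := CharTwo.two_eq_zero
  obtain ⟨α, hα⟩ := exists_root_F8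
  have h0 := ne_zero_of_root hα
  have h1 := ne_one_of_root hα
  have line {a : 𝔽₈} (ha : a ^ 3 + a ^ 2 + 1 = 0) :
      IsLineOfS₁F8 (Submodule.span 𝔽₈ {![1, 0, 0, 0], ![0, a, 1, 0]}) := by
    apply isLineOfS₁F8_span_pair (linearIndependent_pair_of_apply (i := 0) (by simp)
      (fun h => by simpa using congrFun h 2) (by simp))
    all_goals simp [eval_f₁, polarF₁, ha]
  have ne {a b : 𝔽₈} (hab : a ≠ b) : Submodule.span 𝔽₈ {![1, 0, 0, 0], ![0, a, 1, 0]}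
      ≠ Submodule.span 𝔽₈ {![1, 0, 0, 0], ![0, b, 1, 0]} := by
    intro h
    have hb : ![0, a, 1, 0] ∈ Submodule.span 𝔽₈ {![1, 0, 0, 0], ![0, b, 1, 0]} :=
      h ▸ Submodule.subset_span (by simp)
    obtain ⟨s, t, h⟩ := Submodule.mem_span_pair.mp hb
    have e1 := congrFun h 1
    have e2 := congrFun h 2
    simp at e1 e2
    simp [e2] at e1
    exact hab e1.symm
  refine ⟨_, _, _, ne (a := α) (b := α ^ 2) ?_, ne (b := α ^ 2 + α + 1) ?_, ne ?_, line hα,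
    line ((root_iff hα).mpr (by simp)), line ((root_iff hα).mpr (by simp)),
    Submodule.subset_span (by simp), Submodule.subset_span (by simp),
    Submodule.subset_span (by simp)⟩ <;> grind

theorem liesOnThreeLines_smul_iff {v : Fin 4 → 𝔽₈} {t : 𝔽₈} (ht : t ≠ 0) :
    LiesOnThreeLines (t • v) ↔ LiesOnThreeLines v := by
  simp only [LiesOnThreeLines, Submodule.smul_mem_iff _ ht]

theorem liesOnThreeLines_rep_mk_iff {v : Fin 4 → 𝔽₈} (hv : v ≠ 0) :
    LiesOnThreeLines (Projectivization.mk 𝔽₈ v hv).rep ↔ LiesOnThreeLines v := by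
  obtain ⟨t, ht⟩ := Projectivization.exists_smul_eq_mk_rep 𝔽₈ v hv
  rw [← ht, Units.smul_def, liesOnThreeLines_smul_iff t.ne_zero]

theorem normalized_ne_zero {K : Type*} [Field K] (x a : K) : ![x, a, 1, 0] ≠ 0 :=
  fun h => by simpa using congrFun h 2

theorem basis_ne_zero {K : Type*} [Field K] : (![1, 0, 0, 0] : Fin 4 → K) ≠ 0 :=
  fun h => by simpa using congrFun h 0

/-- The point `[x : a : 1 : 0]`, indexed by the pair `⟨a, x⟩`. -/
noncomputable def normalizedPoint (p : Σ _ : 𝔽₈, 𝔽₈) : Projectivization 𝔽₈ (Fin 4 → 𝔽₈) :=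
  .mk 𝔽₈ ![p.2, p.1, 1, 0] (normalized_ne_zero _ _)

theorem normalizedPoint_injective : Function.Injective normalizedPoint := by
  rintro ⟨a, x⟩ ⟨b, y⟩ h
  obtain ⟨t, ht⟩ := (Projectivization.mk_eq_mk_iff' ..).mp h
  have e0 := congrFun ht 0
  have e1 := congrFun ht 1
  have e2 := congrFun ht 2
  simp at e0 e1 e2
  simp_all

theorem basis_ne_normalizedPoint (p : Σ _ : 𝔽₈, 𝔽₈) :
    Projectivization.mk 𝔽₈ ![1, 0, 0, 0] basis_ne_zero ≠ normalizedPoint p := by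
  intro h
  obtain ⟨t, ht⟩ := (Projectivization.mk_eq_mk_iff' ..).mp h
  have e0 := congrFun ht 0
  have e2 := congrFun ht 2
  simp at e0 e2
  simp [e2] at e0

theorem eq_basis_or_eq_normalizedPoint {v : Fin 4 → 𝔽₈} (hv : v ≠ 0) (h : LiesOnThreeLines v) :
    Projectivization.mk 𝔽₈ v hv = .mk 𝔽₈ ![1, 0, 0, 0] basis_ne_zero
      ∨ ∃ p, Projectivization.mk 𝔽₈ v hv = normalizedPoint p := by
  have h3 := h.apply_three_eq_zero
  obtain ⟨W, -, -, -, -, -, L, -, -, hvW, -, -⟩ := h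
  have hf := L.2 v hvW
  simp only [eval_f₁, h3] at hf
  by_cases hz : v 2 = 0
  · have hy : v 1 = 0 := by simpa [hz] using hf
    left
    refine (Projectivization.mk_eq_mk_iff' ..).mpr ⟨v 0, ?_⟩
    ext i
    fin_cases i <;> simp [*]
  · right
    refine ⟨⟨v 1 / v 2, v 0 / v 2⟩, (Projectivization.mk_eq_mk_iff' ..).mpr ⟨v 2, ?_⟩⟩
    ext i
    fin_cases i <;> simp [mul_div_cancel₀, *]

open Classical in
theorem setOf_liesOnThreeLines {α : 𝔽₈} (hα : α ^ 3 + α ^ 2 + 1 = 0) :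
    {x : Projectivization 𝔽₈ (Fin 4 → 𝔽₈) | LiesOnThreeLines x.rep} =
      insert (.mk 𝔽₈ ![1, 0, 0, 0] basis_ne_zero)
        (normalizedPoint '' (({α, α ^ 2, α ^ 2 + α + 1} : Finset 𝔽₈).sigma
          fun a => ({0, 1, a, a + 1} : Finset 𝔽₈))) := by
  have mem (p : Σ _ : 𝔽₈, 𝔽₈) : p ∈ ({α, α ^ 2, α ^ 2 + α + 1} : Finset 𝔽₈).sigma
      (fun a => ({0, 1, a, a + 1} : Finset 𝔽₈)) ↔ LiesOnThreeLines (normalizedPoint p).rep := by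
    rw [normalizedPoint, liesOnThreeLines_rep_mk_iff, liesOnThreeLines_normalized_iff,
      root_iff hα]
    simp
  ext x
  constructor
  · intro h
    have hx := eq_basis_or_eq_normalizedPoint x.rep_nonzero h
    rw [x.mk_rep] at hx
    rcases hx with hx | ⟨p, rfl⟩
    · exact .inl hx
    · exact .inr ⟨p, (mem p).mpr h, rfl⟩
  · rintro (rfl | ⟨p, hp, rfl⟩)
    · exact (liesOnThreeLines_rep_mk_iff _).mpr liesOnThreeLines_basis
    · exact (mem p).mp hp

/-- Exactly thirteen of the `121` points of the cubic surface `S₁` over `𝔽₈` are Eckardt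
points, i.e. lie on three distinct lines of the surface defined over `𝔽₈`. -/
theorem S₁_card_Eckardt_points_over_F8 :
    {x : Projectivization (GaloisField 2 3) (Fin 4 → GaloisField 2 3) |
        eval x.rep (f₁ (GaloisField 2 3)) = 0
          ∧ ∃ W₁ W₂ W₃ : Submodule (GaloisField 2 3) (Fin 4 → GaloisField 2 3),
              W₁ ≠ W₂ ∧ W₁ ≠ W₃ ∧ W₂ ≠ W₃
                ∧ IsLineOfS₁F8 W₁ ∧ IsLineOfS₁F8 W₂ ∧ IsLineOfS₁F8 W₃
                ∧ x.rep ∈ W₁ ∧ x.rep ∈ W₂ ∧ x.rep ∈ W₃}.ncard = 13 := by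
  classical
  have h2 : (2 : 𝔽₈) = 0 := CharTwo.two_eq_zero
  obtain ⟨α, hα⟩ := exists_root_F8
  have hset := setOf_liesOnThreeLines hα
  trans {x : Projectivization 𝔽₈ (Fin 4 → 𝔽₈) | LiesOnThreeLines x.rep}.ncard
  · congr 1
    ext x
    refine ⟨fun h => h.2, fun h => ⟨?_, h⟩⟩
    obtain ⟨W, -, -, -, -, -, L, -, -, hW, -, -⟩ := h
    exact L.2 _ hW
  have card_fibre {a : 𝔽₈} (ha : a ^ 3 + a ^ 2 + 1 = 0) :
      ({0, 1, a, a + 1} : Finset 𝔽₈).card = 4 := by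
    have h0 := ne_zero_of_root ha
    have h1 := ne_one_of_root ha
    have h01 : a + 1 ≠ 0 := by grind
    rw [Finset.card_insert_of_notMem, Finset.card_eq_three.mpr
      ⟨_, _, _, h1.symm, by grind, by grind, rfl⟩]
    simp [h0.symm, h01.symm]
  have card_roots : ({α, α ^ 2, α ^ 2 + α + 1} : Finset 𝔽₈).card = 3 :=
    Finset.card_eq_three.mpr ⟨_, _, _, by grind, by grind, by grind, rfl⟩
  rw [hset, Set.ncard_insert_of_notMem, Set.ncard_image_of_injective _ normalizedPoint_injective,
    Set.ncard_coe_finset, Finset.card_sigma, Finset.sum_const_nat (m := 4), card_roots]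
  · exact fun a ha => card_fibre ((root_iff hα).mpr (by simpa using ha))
  · rintro ⟨p, -, hp⟩
    exact basis_ne_normalizedPoint p hp.symm
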